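/- Let p > q > 1 and V > 0. Define, for y > 0, G_V(y) = Σ_{(m,n)∈ℤ²∖{0}} (V(y²m² + y^{−2}n²))^{−p} + Σ_{(m,n)∈ℤ²∖{0}} (−1)^{m+n}(V(y²m² + y^{−2}n²))^{−q}, the alternating-charge energy of the rectangular lattice V^{1/2}(yℤ × y^{−1}ℤ). If V > V_{p,q} := (S₁(p)/(−S₂(q)))^{1/(p−q)}, then y = 1 is a strict local maximum of G_V on (0,∞). -/

import Mathlib

noncomputable section

/-- Alternating-charge inverse-power-law energy of the rectangular lattice
`V^{1/2}(yℤ × y⁻¹ℤ)`: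
`G_V(y) = Σ_{(m,n)≠0} (V(y²m² + y⁻²n²))^{-p} + Σ_{(m,n)≠0} (-1)^{m+n}(V(y²m² + y⁻²n²))^{-q}`. -/
def G (p q V y : ℝ) : ℝ :=
  (∑' x : {x : ℤ × ℤ // x ≠ 0},
      (V * (y ^ 2 * (x.1.1 : ℝ) ^ 2 + (y⁻¹) ^ 2 * (x.1.2 : ℝ) ^ 2)) ^ (-p))
  + ∑' x : {x : ℤ × ℤ // x ≠ 0},
      (-1 : ℝ) ^ (x.1.1 + x.1.2) *
        (V * (y ^ 2 * (x.1.1 : ℝ) ^ 2 + (y⁻¹) ^ 2 * (x.1.2 : ℝ) ^ 2)) ^ (-q)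

/-- `S₁(p) = 4p Σ_{(m,n)≠0} [(p+1)(n²-m²)² - 2m⁴ - 2m²n²]/(m²+n²)^{p+2}`. -/
def S1 (p : ℝ) : ℝ :=
  4 * p * ∑' x : {x : ℤ × ℤ // x ≠ 0},
    ((p + 1) * ((x.1.2 : ℝ) ^ 2 - (x.1.1 : ℝ) ^ 2) ^ 2
        - 2 * (x.1.1 : ℝ) ^ 4 - 2 * (x.1.1 : ℝ) ^ 2 * (x.1.2 : ℝ) ^ 2)
      / ((x.1.1 : ℝ) ^ 2 + (x.1.2 : ℝ) ^ 2) ^ (p + 2)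

/-- `S₂(q) = 4q Σ_{(m,n)≠0} (-1)^{m+n}[(q+1)(n²-m²)² - 2m⁴ - 2m²n²]/(m²+n²)^{q+2}`. -/
def S2 (q : ℝ) : ℝ :=
  4 * q * ∑' x : {x : ℤ × ℤ // x ≠ 0},
    (-1 : ℝ) ^ (x.1.1 + x.1.2) *
      ((q + 1) * ((x.1.2 : ℝ) ^ 2 - (x.1.1 : ℝ) ^ 2) ^ 2
          - 2 * (x.1.1 : ℝ) ^ 4 - 2 * (x.1.1 : ℝ) ^ 2 * (x.1.2 : ℝ) ^ 2)
      / ((x.1.1 : ℝ) ^ 2 + (x.1.2 : ℝ) ^ 2) ^ (q + 2)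

open Real Filter Topology MeasureTheory

/-- The `j`-th moment `∑ w(n) (n + a)^{2j} e^{-s (n + a)²}` of a weighted, shifted theta series. -/
def thetaMoment (w : ℤ → ℝ) (a : ℝ) (j : ℕ) (s : ℝ) : ℝ :=
  ∑' n : ℤ, w n * (((n : ℝ) + a) ^ 2) ^ j * exp (-(s * ((n : ℝ) + a) ^ 2))

lemma summable_thetaMoment {w : ℤ → ℝ} (hw : ∀ n, |w n| ≤ 1) (a : ℝ) (j : ℕ) {s : ℝ}
    (hs : 0 < s) :
    Summable fun n : ℤ => w n * (((n : ℝ) + a) ^ 2) ^ j * exp (-(s * ((n : ℝ) + a) ^ 2)) := by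
  have hsum : Summable fun n : ℤ =>
      ((j + 1).factorial / s ^ (j + 1) : ℝ) * (1 / |(n : ℝ) + a| ^ (2 : ℝ)) :=
    ((Real.summable_one_div_int_add_rpow a 2).2 one_lt_two).mul_left _
  refine hsum.of_norm_bounded_eventually ?_
  have hfin : {n : ℤ | (n : ℝ) + a = 0}.Finite := by
    refine Set.Subsingleton.finite fun m hm n hn => ?_
    have : (m : ℝ) = n := by
      simp only [Set.mem_ofPred_eq] at hm hn
      linarith
    exact_mod_cast this
  filter_upwards [hfin.compl_mem_cofinite] with n hn
  have hk : 0 < ((n : ℝ) + a) ^ 2 := by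
    have : (n : ℝ) + a ≠ 0 := hn
    positivity
  rw [show |(n : ℝ) + a| ^ (2 : ℝ) = ((n : ℝ) + a) ^ 2 by
    rw [show (2 : ℝ) = ((2 : ℕ) : ℝ) by norm_num, Real.rpow_natCast, sq_abs]]
  generalize ((n : ℝ) + a) ^ 2 = k at hk
  have h1 := Real.pow_div_factorial_le_exp (s * k) (by positivity) (j + 1)
  rw [norm_mul, norm_mul, Real.norm_eq_abs, Real.norm_of_nonneg (by positivity : 0 ≤ k ^ j),
    Real.norm_of_nonneg (exp_pos _).le, Real.exp_neg]
  have hfac : (0 : ℝ) < (j + 1).factorial := by positivity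
  calc |w n| * k ^ j * (exp (s * k))⁻¹ ≤ 1 * k ^ j * ((s * k) ^ (j + 1) / (j + 1).factorial)⁻¹ := by
        gcongr
        exact hw n
    _ = _ := by
        rw [mul_pow, pow_succ k]
        field_simp

lemma hasDerivAt_thetaMoment {w : ℤ → ℝ} (hw : ∀ n, |w n| ≤ 1) (a : ℝ) (j : ℕ) {s : ℝ}
    (hs : 0 < s) :
    HasDerivAt (thetaMoment w a j) (-thetaMoment w a (j + 1) s) s := by
  have h := hasDerivAt_tsum_of_isPreconnected (𝕜 := ℝ) (F := ℝ) (t := Set.Ioi (s / 2)) (y₀ := s)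
    (y := s)
    (u := fun n : ℤ => 1 * (((n : ℝ) + a) ^ 2) ^ (j + 1) * exp (-(s / 2 * ((n : ℝ) + a) ^ 2)))
    (g := fun n x => w n * (((n : ℝ) + a) ^ 2) ^ j * exp (-(x * ((n : ℝ) + a) ^ 2)))
    (g' := fun n x =>
      -(w n * (((n : ℝ) + a) ^ 2) ^ (j + 1) * exp (-(x * ((n : ℝ) + a) ^ 2))))
    (summable_thetaMoment (w := fun _ => 1) (by simp) a (j + 1) (half_pos hs)) isOpen_Ioi
    isPreconnected_Ioi ?_ ?_ (half_lt_self hs) (summable_thetaMoment hw a j hs) (half_lt_self hs)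
  · rw [tsum_neg] at h
    exact h
  · intro n x _
    have h2 := ((((hasDerivAt_id x).mul_const (((n : ℝ) + a) ^ 2)).neg).exp).const_mul
      (w n * (((n : ℝ) + a) ^ 2) ^ j)
    refine h2.congr_deriv ?_
    simp only [Pi.neg_apply, id]
    ring
  · intro n x hx
    have hx' : s / 2 < x := hx
    rw [norm_neg, norm_mul, norm_mul, Real.norm_eq_abs, Real.norm_of_nonneg (by positivity),
      Real.norm_of_nonneg (exp_pos _).le]
    gcongr
    exact hw n

lemma abs_neg_one_zpow_le (n : ℤ) : |(-1 : ℝ) ^ n| ≤ 1 := by simp [abs_zpow]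

lemma thetaMoment_one_half_zero_pos {s : ℝ} (hs : 0 < s) :
    0 < thetaMoment (fun _ => 1) (1 / 2) 0 s :=
  (summable_thetaMoment (by simp) _ _ hs).tsum_pos (fun _ => by positivity) 0 (by positivity)

/-- Poisson summation for the alternating theta series. -/
lemma thetaMoment_alternating_eq {t : ℝ} (ht : 0 < t) :
    thetaMoment (fun n => (-1) ^ n) 0 0 t =
      (t / π) ^ (-(1 / 2) : ℝ) * thetaMoment (fun _ => 1) (1 / 2) 0 (π ^ 2 / t) := by
  have hpi := Real.pi_pos
  have h := Complex.tsum_exp_neg_quadratic (a := ((t / π : ℝ) : ℂ))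
    (by rw [Complex.ofReal_re]; positivity) (-Complex.I / 2)
  have hπ : (π : ℂ) ≠ 0 := by exact_mod_cast hpi.ne'
  have htc : (t : ℂ) ≠ 0 := by exact_mod_cast ht.ne'
  unfold thetaMoment
  rw [← Complex.ofReal_inj]
  push_cast
  convert h using 1
  · refine tsum_congr fun n => ?_
    rw [Complex.exp_add, mul_comm]
    congr 1
    · congr 1
      push_cast
      field_simp
      ring
    · rw [show 2 * (π : ℂ) * (-Complex.I / 2) * n = (n : ℂ) * (-(π * Complex.I)) by ring,
        Complex.exp_int_mul, Complex.exp_neg, Complex.exp_pi_mul_I]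
      norm_num
  · congr 1
    · rw [Complex.ofReal_cpow (by positivity)]
      push_cast
      rw [Complex.cpow_neg, one_div, one_div]
    · refine tsum_congr fun n => ?_
      rw [pow_zero, one_mul, one_mul]
      congr 1
      have : (Complex.I * (-Complex.I / 2)) = 1 / 2 := by
        linear_combination (-1 / 2) * Complex.I_sq
      rw [this]
      push_cast
      field_simp

lemma hasSum_half_pow_natAbs : HasSum (fun n : ℤ => (1 / 2 : ℝ) ^ n.natAbs) 3 := by
  have h1 : HasSum (fun n : ℕ => (1 / 2 : ℝ) ^ (n : ℤ).natAbs) 2 := by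
    simpa only [Int.natAbs_natCast] using hasSum_geometric_two
  have h2 : HasSum (fun n : ℕ => (1 / 2 : ℝ) ^ (-((n : ℤ) + 1)).natAbs) (1 / 2 * 2) := by
    have heq : (fun n : ℕ => (1 / 2 : ℝ) ^ (-((n : ℤ) + 1)).natAbs) =
        fun n => 1 / 2 * (1 / 2) ^ n := by
      funext n
      rw [show (-((n : ℤ) + 1)).natAbs = n + 1 by omega, pow_succ']
    rw [heq]
    exact hasSum_geometric_two.mul_left (1 / 2 : ℝ)
  have h3 := HasSum.of_nat_of_neg_add_one (f := fun n : ℤ => (1 / 2 : ℝ) ^ n.natAbs) h1 h2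
  rwa [show (2 : ℝ) + 1 / 2 * 2 = 3 by norm_num] at h3

/-- A series over `ℤ` dominated by `X / 4 · 2^{-|n|}` apart from one entry that is at most `-X`
has negative sum. -/
lemma tsum_neg_of_dominated {f : ℤ → ℝ} (hf : Summable f) {X : ℝ} (hX : 0 < X) (n₀ : ℤ)
    (h₀ : f n₀ ≤ -X) (h : ∀ n, n ≠ n₀ → f n ≤ X / 4 * (1 / 2) ^ n.natAbs) :
    ∑' n, f n < 0 := by
  have hs := (hasSum_half_pow_natAbs.mul_left (X / 4)).sub (hasSum_ite_eq n₀ X)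
  have hle := hasSum_le (fun n => ?_) hf.hasSum hs
  · linarith
  · by_cases hn : n = n₀
    · subst hn
      simp only [if_true]
      have : (0 : ℝ) ≤ X / 4 * (1 / 2) ^ n.natAbs := by positivity
      linarith
    · simpa [hn] using h n hn

lemma thetaMoment_alternating_large {t : ℝ} (ht : 9 / 4 ≤ t) :
    t * thetaMoment (fun n => (-1) ^ n) 0 2 t - thetaMoment (fun n => (-1) ^ n) 0 1 t < 0 := by
  have ht0 : 0 < t := by linarith
  have s2 := (summable_thetaMoment abs_neg_one_zpow_le 0 2 ht0).mul_left t
  have s1 := summable_thetaMoment abs_neg_one_zpow_le 0 1 ht0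
  unfold thetaMoment
  rw [← tsum_mul_left, ← s2.tsum_sub s1]
  refine tsum_neg_of_dominated (s2.sub s1) (X := (t - 1) * exp (-t))
    (mul_pos (by linarith) (exp_pos _)) 1 (by norm_num; linarith) fun n hn => ?_
  simp only [add_zero]
  rcases eq_or_ne n 0 with rfl | h0
  · simp only [Int.cast_zero]
    have : 0 < (t - 1) * exp (-t) := mul_pos (by linarith) (exp_pos _)
    norm_num
    linarith
  rcases eq_or_ne n (-1) with rfl | h1
  · norm_num
    have : 0 < (t - 1) * exp (-t) := mul_pos (by linarith) (exp_pos _)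
    nlinarith
  have hn2 : 2 ≤ n.natAbs := by omega
  obtain ⟨y, hy⟩ : ∃ y : ℕ, n.natAbs ^ 2 = y + 1 :=
    ⟨n.natAbs ^ 2 - 1, by have : 0 < n.natAbs ^ 2 := by positivity
                          omega⟩
  have hcast : (n : ℝ) ^ 2 = y + 1 := by
    have : (n : ℤ) ^ 2 = y + 1 := by rw [← Int.natAbs_sq]; exact_mod_cast hy
    exact_mod_cast this
  have hy3 : 3 ≤ y := by nlinarith
  have hny : n.natAbs + 1 ≤ y := by nlinarith
  rw [hcast]
  have hE : (4 : ℝ) * (y + 1) ^ 2 * 2 ^ y ≤ exp (t * y) := by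
    have e9 : (9 : ℝ) ≤ exp t := by
      refine le_trans ?_ (exp_le_exp.2 ht)
      rw [show (9 / 4 : ℝ) = 2 + 1 / 4 by norm_num, Real.exp_add,
        show (2 : ℝ) = 1 + 1 by norm_num, Real.exp_add]
      have := Real.exp_one_gt_d9
      have := Real.add_one_le_exp (1 / 4 : ℝ)
      nlinarith
    have hnat : ∀ k : ℕ, 3 ≤ k → 4 * (k + 1) ^ 2 * 2 ^ k ≤ 9 ^ k := by
      intro k hk
      induction k, hk using Nat.le_induction with
      | base => norm_num
      | succ k hk ih =>
        rw [pow_succ 9, pow_succ 2]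
        have : (k + 1 + 1) ^ 2 ≤ 4 * (k + 1) ^ 2 := by nlinarith
        have h2 : 0 < 2 ^ k := by positivity
        nlinarith
    rw [mul_comm t, Real.exp_nat_mul]
    refine le_trans ?_ (pow_le_pow_left₀ (by norm_num) e9 y)
    exact_mod_cast hnat y hy3
  have hpow : (2 : ℝ) * 2 ^ n.natAbs ≤ 2 ^ y := by
    rw [← pow_succ']
    exact pow_le_pow_right₀ (by norm_num) hny
  have hexp : exp (-(t * (y + 1))) = exp (-t) * (exp (t * y))⁻¹ := by
    rw [← Real.exp_neg, ← Real.exp_add]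
    ring_nf
  have hEpos := exp_pos (t * y)
  have key : t * ((y : ℝ) + 1) ^ 2 * (exp (t * y))⁻¹ ≤ (t - 1) / 4 * (1 / 2) ^ n.natAbs := by
    rw [one_div, inv_pow, ← div_eq_mul_inv, ← div_eq_mul_inv, div_le_div_iff₀ hEpos (by positivity)]
    have h2pos : (0 : ℝ) < 2 ^ n.natAbs := by positivity
    calc t * ((y : ℝ) + 1) ^ 2 * 2 ^ n.natAbs
        = t / 8 * (4 * (y + 1) ^ 2 * (2 * 2 ^ n.natAbs)) := by ring
      _ ≤ t / 8 * (4 * (y + 1) ^ 2 * 2 ^ y) := by gcongr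
      _ ≤ t / 8 * exp (t * y) := by gcongr
      _ ≤ (t - 1) / 4 * exp (t * y) := mul_le_mul_of_nonneg_right (by linarith) hEpos.le
  have hterm : t * ((-1) ^ n * ((y : ℝ) + 1) ^ 2 * exp (-(t * (y + 1)))) -
      (-1) ^ n * ((y : ℝ) + 1) ^ 1 * exp (-(t * (y + 1))) ≤
      t * ((y : ℝ) + 1) ^ 2 * exp (-(t * (y + 1))) := by
    have hpos := exp_pos (-(t * ((y : ℝ) + 1)))
    have hb := abs_le.1 (abs_neg_one_zpow_le n)
    have hy0 : (0 : ℝ) ≤ y := by positivity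
    have hc : 0 ≤ (t * ((y : ℝ) + 1) ^ 2 - (y + 1)) * exp (-(t * ((y : ℝ) + 1))) := by
      refine mul_nonneg ?_ hpos.le
      nlinarith
    have hc' : 0 ≤ ((y : ℝ) + 1) * exp (-(t * ((y : ℝ) + 1))) := by positivity
    nlinarith
  refine hterm.trans ?_
  rw [hexp]
  calc _ = exp (-t) * (t * ((y : ℝ) + 1) ^ 2 * (exp (t * y))⁻¹) := by ring
    _ ≤ exp (-t) * ((t - 1) / 4 * (1 / 2) ^ n.natAbs) := by gcongr
    _ = _ := by ring

lemma thetaMoment_half_large {s : ℝ} (hs : 4 ≤ s) :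
    s * (thetaMoment (fun _ => 1) (1 / 2) 2 s - thetaMoment (fun _ => 1) (1 / 2) 1 s / 2 +
      thetaMoment (fun _ => 1) (1 / 2) 0 s / 16) - thetaMoment (fun _ => 1) (1 / 2) 1 s < 0 := by
  have hs0 : 0 < s := by linarith
  have hw : ∀ n : ℤ, |(fun _ => 1 : ℤ → ℝ) n| ≤ 1 := by simp
  have s2 := summable_thetaMoment hw (1 / 2) 2 hs0
  have s1 := summable_thetaMoment hw (1 / 2) 1 hs0
  have s0 := summable_thetaMoment hw (1 / 2) 0 hs0
  unfold thetaMoment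
  have hS := (((s2.hasSum.sub (s1.hasSum.div_const 2)).add (s0.hasSum.div_const 16)).mul_left s).sub
    s1.hasSum
  rw [← hS.tsum_eq]
  refine tsum_neg_of_dominated hS.summable (X := 1 / 4 * exp (-(s / 4))) (by positivity) 0 ?_
    fun n hn => ?_
  · norm_num
    rw [show s * (1 / 4) = s / 4 by ring]
    apply le_of_eq
    ring
  obtain ⟨u, hu⟩ : ∃ u : ℕ, n * (n + 1) = u := by
    refine Int.eq_ofNat_of_zero_le ?_
    rcases le_or_gt 0 n with h | h <;> nlinarith
  have hcast : ((n : ℝ) + 1 / 2) ^ 2 = u + 1 / 4 := by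
    have : (n : ℝ) * (n + 1) = u := by exact_mod_cast hu
    linear_combination this
  rw [hcast]
  have hexp : exp (-(s * ((u : ℝ) + 1 / 4))) = exp (-(s / 4)) * (exp (s * u))⁻¹ := by
    rw [← Real.exp_neg, ← Real.exp_add]
    ring_nf
  rcases eq_or_ne n (-1) with rfl | h1
  · have hu0 : u = 0 := by omega
    subst hu0
    rw [hexp]
    norm_num
    have := exp_pos (-(s / 4))
    nlinarith
  have hu2 : 2 ≤ u := by
    have : (2 : ℤ) ≤ u := by
      rw [← hu]
      rcases lt_or_gt_of_ne hn with h | h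
      · have : n ≤ -2 := by omega
        nlinarith
      · nlinarith
    exact_mod_cast this
  have hnu : n.natAbs ≤ u := by
    zify
    rw [← hu]
    rcases lt_or_gt_of_ne hn with h | h
    · rw [abs_of_neg h]
      have : n ≤ -2 := by omega
      nlinarith
    · rw [abs_of_pos h]
      nlinarith
  have hE : 16 * s * (u : ℝ) ^ 2 * 2 ^ u ≤ exp (s * u) := by
    have e50 : (50 : ℝ) ≤ exp 4 := by
      rw [show (4 : ℝ) = ((4 : ℕ) : ℝ) * 1 by norm_num, Real.exp_nat_mul]
      have : (2.7 : ℝ) ≤ exp 1 := by linarith [Real.exp_one_gt_d9]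
      refine le_trans ?_ (pow_le_pow_left₀ (by norm_num) this 4)
      norm_num
    have hnat : ∀ k : ℕ, 2 ≤ k → 64 * k ^ 2 * 2 ^ k ≤ 50 ^ k := by
      intro k hk
      induction k, hk using Nat.le_induction with
      | base => norm_num
      | succ k hk ih =>
        rw [pow_succ 50, pow_succ 2]
        have : (k + 1) ^ 2 ≤ 4 * k ^ 2 := by nlinarith
        have h2 : 0 < 2 ^ k := by positivity
        nlinarith
    have hu1 : (2 : ℝ) ≤ u := by exact_mod_cast hu2
    have h4 : (64 : ℝ) * u ^ 2 * 2 ^ u ≤ exp (4 * u) := by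
      rw [mul_comm 4 (u : ℝ), Real.exp_nat_mul]
      refine le_trans ?_ (pow_le_pow_left₀ (by norm_num) e50 u)
      exact_mod_cast hnat u hu2
    have h5 : s / 4 ≤ exp ((s - 4) * u) := by
      refine le_trans ?_ (Real.add_one_le_exp _)
      nlinarith
    calc 16 * s * (u : ℝ) ^ 2 * 2 ^ u = s / 4 * (64 * u ^ 2 * 2 ^ u) := by ring
      _ ≤ exp ((s - 4) * u) * exp (4 * u) := by gcongr
      _ = exp (s * u) := by rw [← Real.exp_add]; ring_nf
  have hpow : (2 : ℝ) ^ n.natAbs ≤ 2 ^ u := pow_le_pow_right₀ (by norm_num) hnu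
  have hEpos := exp_pos (s * u)
  have key : s * (u : ℝ) ^ 2 * (exp (s * u))⁻¹ ≤ 1 / 16 * (1 / 2) ^ n.natAbs := by
    rw [one_div 2, inv_pow, ← div_eq_mul_inv, ← div_eq_mul_inv,
      div_le_div_iff₀ hEpos (by positivity)]
    calc s * (u : ℝ) ^ 2 * 2 ^ n.natAbs = 1 / 16 * (16 * s * u ^ 2 * 2 ^ n.natAbs) := by ring
      _ ≤ 1 / 16 * (16 * s * u ^ 2 * 2 ^ u) := by gcongr
      _ ≤ 1 / 16 * exp (s * u) := by gcongr
  rw [hexp]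
  have hpos := exp_pos (-(s / 4))
  calc _ = exp (-(s / 4)) * (s * (u : ℝ) ^ 2 * (exp (s * u))⁻¹ -
        (u + 1 / 4) * (exp (s * u))⁻¹) := by ring
    _ ≤ exp (-(s / 4)) * (s * (u : ℝ) ^ 2 * (exp (s * u))⁻¹) := by
        gcongr
        have : 0 ≤ ((u : ℝ) + 1 / 4) * (exp (s * u))⁻¹ := by positivity
        linarith
    _ ≤ exp (-(s / 4)) * (1 / 16 * (1 / 2) ^ n.natAbs) := by gcongr
    _ = _ := by ring

lemma hasDerivAt_div_pi_rpow {t : ℝ} (ht : 0 < t) :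
    HasDerivAt (fun x : ℝ => (x / π) ^ (-(1 / 2) : ℝ)) (-(t / π) ^ (-(1 / 2) : ℝ) / (2 * t)) t := by
  have hpi := Real.pi_pos
  refine (((hasDerivAt_id t).div_const π).rpow_const (Or.inl (by simp; positivity))).congr_deriv ?_
  simp only [id]
  rw [Real.rpow_sub_one (by positivity)]
  field_simp

lemma hasDerivAt_thetaMoment_comp_inv (j : ℕ) {t : ℝ} (ht : 0 < t) :
    HasDerivAt (fun x => thetaMoment (fun _ => 1) (1 / 2) j (π ^ 2 / x))
      (π ^ 2 / t / t * thetaMoment (fun _ => 1) (1 / 2) (j + 1) (π ^ 2 / t)) t := by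
  have hpi := Real.pi_pos
  have h1 : HasDerivAt (fun x : ℝ => π ^ 2 / x) (-(π ^ 2 / t / t)) t := by
    refine ((hasDerivAt_inv ht.ne').const_mul (π ^ 2)).congr_deriv ?_
    field_simp
  have h2 := hasDerivAt_thetaMoment (w := fun _ => 1) (by simp) (1 / 2) j
    (s := π ^ 2 / t) (by positivity)
  refine (h2.comp t h1).congr_deriv ?_
  ring

lemma thetaMoment_alternating_one_eq {t : ℝ} (ht : 0 < t) :
    thetaMoment (fun n => (-1) ^ n) 0 1 t = (t / π) ^ (-(1 / 2) : ℝ) / t *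
      (thetaMoment (fun _ => 1) (1 / 2) 0 (π ^ 2 / t) / 2 -
        π ^ 2 / t * thetaMoment (fun _ => 1) (1 / 2) 1 (π ^ 2 / t)) := by
  have h1 := hasDerivAt_thetaMoment abs_neg_one_zpow_le 0 0 ht
  have h2 := ((hasDerivAt_div_pi_rpow ht).mul
    (hasDerivAt_thetaMoment_comp_inv 0 ht)).congr_of_eventuallyEq
    (f₁ := thetaMoment (fun n => (-1) ^ n) 0 0)
    (by filter_upwards [eventually_gt_nhds ht] with x hx using thetaMoment_alternating_eq hx)
  have h3 := h1.unique h2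
  simp only [zero_add] at h3
  rw [← neg_inj, h3]
  field_simp
  ring

lemma thetaMoment_alternating_two_eq {t : ℝ} (ht : 0 < t) :
    thetaMoment (fun n => (-1) ^ n) 0 2 t = (t / π) ^ (-(1 / 2) : ℝ) / t ^ 2 *
      (3 / 4 * thetaMoment (fun _ => 1) (1 / 2) 0 (π ^ 2 / t) -
        3 * (π ^ 2 / t) * thetaMoment (fun _ => 1) (1 / 2) 1 (π ^ 2 / t) +
        (π ^ 2 / t) ^ 2 * thetaMoment (fun _ => 1) (1 / 2) 2 (π ^ 2 / t)) := by
  have h1 := hasDerivAt_thetaMoment abs_neg_one_zpow_le 0 1 ht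
  have hs : HasDerivAt (fun x : ℝ => π ^ 2 / x) (-(π ^ 2 / t / t)) t := by
    refine ((hasDerivAt_inv ht.ne').const_mul (π ^ 2)).congr_deriv ?_
    field_simp
  have h2 := (((hasDerivAt_div_pi_rpow ht).div (hasDerivAt_id t) ht.ne').mul
    (((hasDerivAt_thetaMoment_comp_inv 0 ht).div_const 2).sub
      (hs.mul (hasDerivAt_thetaMoment_comp_inv 1 ht)))).congr_of_eventuallyEq
    (f₁ := thetaMoment (fun n => (-1) ^ n) 0 1)
    (by filter_upwards [eventually_gt_nhds ht] with x hx using thetaMoment_alternating_one_eq hx)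
  have h3 := h1.unique h2
  simp only [zero_add, id, Nat.reduceAdd, Pi.div_apply, Pi.sub_apply, Pi.mul_apply] at h3
  rw [← neg_inj, h3]
  field_simp
  ring

/-- `log θ(eᵘ)` is strictly concave, where `θ(t) = ∑ (-1)ⁿ e^{-t n²}`. -/
lemma thetaMoment_alternating_log_concave {t : ℝ} (ht : 0 < t) :
    t * (thetaMoment (fun n => (-1) ^ n) 0 0 t * thetaMoment (fun n => (-1) ^ n) 0 2 t -
      thetaMoment (fun n => (-1) ^ n) 0 1 t ^ 2) -
      thetaMoment (fun n => (-1) ^ n) 0 0 t * thetaMoment (fun n => (-1) ^ n) 0 1 t < 0 := by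
  have hpi := Real.pi_pos
  have hc : 0 < (t / π) ^ (-(1 / 2) : ℝ) := by positivity
  have hs : 0 < π ^ 2 / t := by positivity
  have hB := thetaMoment_one_half_zero_pos hs
  rcases le_total (9 / 4) t with h | h
  · have h1 := thetaMoment_alternating_large h
    have h0 : 0 < thetaMoment (fun n => (-1) ^ n) 0 0 t := by
      rw [thetaMoment_alternating_eq ht]
      positivity
    have := mul_neg_of_pos_of_neg h0 h1
    have := mul_nonneg ht.le (sq_nonneg (thetaMoment (fun n => (-1) ^ n) 0 1 t))
    nlinarith
  · have h4 : 4 ≤ π ^ 2 / t := by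
      rw [le_div_iff₀ ht]
      nlinarith [Real.pi_gt_three]
    have h1 := thetaMoment_half_large h4
    rw [thetaMoment_alternating_eq ht, thetaMoment_alternating_one_eq ht,
      thetaMoment_alternating_two_eq ht]
    generalize thetaMoment (fun _ => 1) (1 / 2) 0 (π ^ 2 / t) = B₀ at *
    generalize thetaMoment (fun _ => 1) (1 / 2) 1 (π ^ 2 / t) = B₁ at *
    generalize thetaMoment (fun _ => 1) (1 / 2) 2 (π ^ 2 / t) = B₂ at *
    generalize (t / π) ^ (-(1 / 2) : ℝ) = c at *
    generalize π ^ 2 / t = s at *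
    have h2 : s * (B₀ * B₂ - B₁ ^ 2) - B₀ * B₁ < 0 := by
      have := mul_neg_of_pos_of_neg hB h1
      have := mul_nonneg hs.le (sq_nonneg (B₁ - B₀ / 4))
      nlinarith
    have h3 : 0 < c ^ 2 * s / t := by positivity
    have := mul_neg_of_pos_of_neg h3 h2
    refine lt_of_eq_of_lt ?_ this
    field_simp
    ring

/-- The nonzero points of `ℤ²`. -/
abbrev PuncturedLattice : Type := {x : ℤ × ℤ // x ≠ 0}

namespace PuncturedLattice

/-- The squared Euclidean length of a lattice point. -/
def normSq (x : PuncturedLattice) : ℝ := (x.1.1 : ℝ) ^ 2 + (x.1.2 : ℝ) ^ 2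

/-- Exchange of the two coordinates. -/
def swap : PuncturedLattice ≃ PuncturedLattice where
  toFun x := ⟨x.1.swap, fun h => x.2 (by simpa [Prod.ext_iff, and_comm] using h)⟩
  invFun x := ⟨x.1.swap, fun h => x.2 (by simpa [Prod.ext_iff, and_comm] using h)⟩
  left_inv x := by simp
  right_inv x := by simp

@[simp] lemma swap_fst (x : PuncturedLattice) : (swap x).1.1 = x.1.2 := rfl

@[simp] lemma swap_snd (x : PuncturedLattice) : (swap x).1.2 = x.1.1 := rfl

lemma normSq_swap (x : PuncturedLattice) : normSq (swap x) = normSq x := by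
  simp [normSq, add_comm]

lemma normSq_pos (x : PuncturedLattice) : 0 < normSq x := by
  have h : x.1.1 ≠ 0 ∨ x.1.2 ≠ 0 := by
    by_contra! h
    exact x.2 (Prod.ext h.1 h.2)
  unfold normSq
  rcases h with h | h
  · have : (x.1.1 : ℝ) ≠ 0 := by exact_mod_cast h
    positivity
  · have : (x.1.2 : ℝ) ≠ 0 := by exact_mod_cast h
    positivity

lemma summable_normSq_rpow {p : ℝ} (hp : 1 < p) :
    Summable fun x : PuncturedLattice => normSq x ^ (-p) := by
  have h1 := EisensteinSeries.summable_one_div_norm_rpow (k := 2 * p) (by linarith)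
  have h2 := h1.comp_injective
    ((finTwoArrowEquiv ℤ).symm.injective.comp (Subtype.val_injective (p := fun x : ℤ × ℤ => x ≠ 0)))
  refine h2.of_nonneg_of_le (fun x => (Real.rpow_pos_of_pos (normSq_pos x) _).le) fun x => ?_
  simp only [Function.comp_apply]
  set z : Fin 2 → ℤ := (finTwoArrowEquiv ℤ).symm x.1 with hz
  have hz0 : z ≠ 0 := by
    intro h
    apply x.2
    have := congrArg (finTwoArrowEquiv ℤ) h
    rw [hz, Equiv.apply_symm_apply] at this
    rw [this]
    rfl
  have hn : 0 < ‖z‖ := norm_pos_iff.2 hz0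
  have hle : ‖z‖ ^ 2 ≤ normSq x := by
    have h3 : ‖z‖ ≤ √(normSq x) := by
      refine (pi_norm_le_iff_of_nonneg (Real.sqrt_nonneg _)).2 fun i => ?_
      rw [Int.norm_eq_abs]
      refine Real.abs_le_sqrt ?_
      fin_cases i <;> simp [hz, normSq, finTwoArrowEquiv] <;> positivity
    calc ‖z‖ ^ 2 ≤ √(normSq x) ^ 2 := by gcongr
      _ = normSq x := Real.sq_sqrt (normSq_pos x).le
  calc normSq x ^ (-p) ≤ (‖z‖ ^ 2) ^ (-p) :=
        Real.rpow_le_rpow_of_nonpos (by positivity) hle (by linarith)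
    _ = ‖z‖ ^ (-(2 * p)) := by
        rw [← Real.rpow_natCast, ← Real.rpow_mul hn.le]
        norm_num

/-- The quadratic form of the rectangular lattice with parameter `y = eᵛ`. -/
def form (x : PuncturedLattice) (v : ℝ) : ℝ :=
  exp (2 * v) * (x.1.1 : ℝ) ^ 2 + exp (-(2 * v)) * (x.1.2 : ℝ) ^ 2

/-- Half of the derivative of `form`. -/
def formDeriv (x : PuncturedLattice) (v : ℝ) : ℝ :=
  exp (2 * v) * (x.1.1 : ℝ) ^ 2 - exp (-(2 * v)) * (x.1.2 : ℝ) ^ 2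

lemma exp_mul_normSq_le_form (x : PuncturedLattice) {v : ℝ} (hv : v ∈ Set.Ioo (-1 : ℝ) 1) :
    exp (-2) * normSq x ≤ form x v := by
  unfold normSq form
  rw [mul_add]
  have h1 : exp (-2) ≤ exp (2 * v) := exp_le_exp.2 (by linarith [hv.1])
  have h2 : exp (-2) ≤ exp (-(2 * v)) := exp_le_exp.2 (by linarith [hv.2])
  gcongr

lemma form_pos (x : PuncturedLattice) {v : ℝ} (hv : v ∈ Set.Ioo (-1 : ℝ) 1) : 0 < form x v :=
  (mul_pos (exp_pos _) (normSq_pos x)).trans_le (exp_mul_normSq_le_form x hv)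

lemma abs_formDeriv_le (x : PuncturedLattice) (v : ℝ) : |formDeriv x v| ≤ form x v := by
  have h1 : 0 ≤ exp (2 * v) * (x.1.1 : ℝ) ^ 2 := by positivity
  have h2 : 0 ≤ exp (-(2 * v)) * (x.1.2 : ℝ) ^ 2 := by positivity
  unfold formDeriv form
  rw [abs_le]
  constructor <;> linarith

lemma form_rpow_le (x : PuncturedLattice) {v p : ℝ} (hv : v ∈ Set.Ioo (-1 : ℝ) 1) (hp : 0 < p) :
    form x v ^ (-p) ≤ exp (2 * p) * normSq x ^ (-p) := by
  have := normSq_pos x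
  calc form x v ^ (-p) ≤ (exp (-2) * normSq x) ^ (-p) :=
        Real.rpow_le_rpow_of_nonpos (by positivity) (exp_mul_normSq_le_form x hv) (by linarith)
    _ = _ := by
        rw [Real.mul_rpow (exp_pos _).le (normSq_pos x).le, ← Real.exp_mul]
        ring_nf

lemma hasDerivAt_exp_two_mul (v : ℝ) :
    HasDerivAt (fun v : ℝ => exp (2 * v)) (2 * exp (2 * v)) v := by
  refine (((hasDerivAt_id v).const_mul 2).exp).congr_deriv ?_
  simp only [id]
  ring

lemma hasDerivAt_exp_neg_two_mul (v : ℝ) :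
    HasDerivAt (fun v : ℝ => exp (-(2 * v))) (-(2 * exp (-(2 * v)))) v := by
  refine ((((hasDerivAt_id v).const_mul 2).fun_neg).exp).congr_deriv ?_
  simp only [id]
  ring

lemma hasDerivAt_form (x : PuncturedLattice) (v : ℝ) :
    HasDerivAt (form x) (2 * formDeriv x v) v := by
  refine (((hasDerivAt_exp_two_mul v).mul_const _).add
    ((hasDerivAt_exp_neg_two_mul v).mul_const _)).congr_deriv ?_
  unfold formDeriv
  ring

lemma hasDerivAt_formDeriv (x : PuncturedLattice) (v : ℝ) :
    HasDerivAt (formDeriv x) (2 * form x v) v := by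
  refine (((hasDerivAt_exp_two_mul v).mul_const _).sub
    ((hasDerivAt_exp_neg_two_mul v).mul_const _)).congr_deriv ?_
  unfold form
  ring

/-- The charged energy `∑ ε(x) Q_v(x)^{-p}` of the rectangular lattice with parameter `eᵛ`. -/
def energy (ε : PuncturedLattice → ℝ) (p v : ℝ) : ℝ := ∑' x, ε x * form x v ^ (-p)

/-- The termwise derivative of `energy`. -/
def energyDeriv (ε : PuncturedLattice → ℝ) (p v : ℝ) : ℝ :=
  ∑' x, ε x * (-2 * p * (form x v ^ (-p - 1) * formDeriv x v))

/-- The termwise second derivative of `energy`. -/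
def energyDeriv₂ (ε : PuncturedLattice → ℝ) (p v : ℝ) : ℝ :=
  ∑' x, ε x * (4 * p * (p + 1) * (form x v ^ (-p - 2) * formDeriv x v ^ 2) -
    4 * p * form x v ^ (-p))

variable {ε : PuncturedLattice → ℝ} {p v : ℝ}

lemma summable_mul_of_abs_le (hε : ∀ x, |ε x| ≤ 1) (hp : 1 < p) {f : PuncturedLattice → ℝ} {C : ℝ}
    (hf : ∀ x, |f x| ≤ C * normSq x ^ (-p)) : Summable fun x => ε x * f x := by
  refine ((summable_normSq_rpow hp).mul_left C).of_norm_bounded fun x => ?_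
  rw [Real.norm_eq_abs, abs_mul]
  exact (mul_le_of_le_one_left (abs_nonneg _) (hε x)).trans (hf x)

lemma abs_energyDeriv_term_le (x : PuncturedLattice) (hv : v ∈ Set.Ioo (-1 : ℝ) 1) (hp : 0 < p) :
    |-2 * p * (form x v ^ (-p - 1) * formDeriv x v)| ≤
      2 * p * exp (2 * p) * normSq x ^ (-p) := by
  have hf := form_pos x hv
  have hD := abs_formDeriv_le x v
  rw [abs_mul, abs_mul, abs_mul, abs_of_pos hp, abs_of_pos (Real.rpow_pos_of_pos hf _)]
  norm_num
  calc 2 * p * (form x v ^ (-p - 1) * |formDeriv x v|)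
      ≤ 2 * p * (form x v ^ (-p - 1) * form x v) := by gcongr
    _ = 2 * p * form x v ^ (-p) := by
        rw [Real.rpow_sub_one hf.ne']
        field_simp
    _ ≤ 2 * p * (exp (2 * p) * normSq x ^ (-p)) := by
        have := form_rpow_le x hv hp
        gcongr
    _ = _ := by ring

lemma abs_energyDeriv₂_term_le (x : PuncturedLattice) (hv : v ∈ Set.Ioo (-1 : ℝ) 1) (hp : 0 < p) :
    |4 * p * (p + 1) * (form x v ^ (-p - 2) * formDeriv x v ^ 2) - 4 * p * form x v ^ (-p)| ≤
      4 * p * (p + 2) * exp (2 * p) * normSq x ^ (-p) := by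
  have hf := form_pos x hv
  have hD : formDeriv x v ^ 2 ≤ form x v ^ 2 := sq_le_sq' (abs_le.1 (abs_formDeriv_le x v)).1
    (abs_le.1 (abs_formDeriv_le x v)).2
  have h2 : form x v ^ (-p - 2) * form x v ^ 2 = form x v ^ (-p) := by
    rw [show (-p - 2 : ℝ) = -p - (2 : ℕ) by norm_num, Real.rpow_sub_natCast hf.ne']
    field_simp
  have h3 : form x v ^ (-p - 2) * formDeriv x v ^ 2 ≤ form x v ^ (-p) := by
    rw [← h2]
    gcongr
  have h4 : 0 ≤ form x v ^ (-p - 2) * formDeriv x v ^ 2 := by positivity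
  calc _ ≤ |4 * p * (p + 1) * (form x v ^ (-p - 2) * formDeriv x v ^ 2)| +
        |4 * p * form x v ^ (-p)| := abs_sub _ _
    _ = 4 * p * (p + 1) * (form x v ^ (-p - 2) * formDeriv x v ^ 2) +
        4 * p * form x v ^ (-p) := by
        rw [abs_of_nonneg (by positivity), abs_of_nonneg (by positivity)]
    _ ≤ 4 * p * (p + 1) * form x v ^ (-p) + 4 * p * form x v ^ (-p) := by gcongr
    _ = 4 * p * (p + 2) * form x v ^ (-p) := by ring
    _ ≤ 4 * p * (p + 2) * (exp (2 * p) * normSq x ^ (-p)) := by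
        have := form_rpow_le x hv hp
        gcongr
    _ = _ := by ring

lemma hasDerivAt_energy (hε : ∀ x, |ε x| ≤ 1) (hp : 1 < p) (hv : v ∈ Set.Ioo (-1 : ℝ) 1) :
    HasDerivAt (energy ε p) (energyDeriv ε p v) v := by
  have hp0 : 0 < p := by linarith
  refine hasDerivAt_tsum_of_isPreconnected (𝕜 := ℝ) (F := ℝ)
    (g := fun x v => ε x * form x v ^ (-p))
    (g' := fun x v => ε x * (-2 * p * (form x v ^ (-p - 1) * formDeriv x v)))
    ((summable_normSq_rpow hp).mul_left (2 * p * exp (2 * p))) isOpen_Ioo isPreconnected_Ioo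
    (fun x u hu => ?_) (fun x u hu => ?_) hv ?_ hv
  · have hf := form_pos x hu
    refine (((hasDerivAt_form x u).rpow_const (p := -p) (Or.inl hf.ne')).const_mul
      (ε x)).congr_deriv ?_
    ring
  · rw [Real.norm_eq_abs, abs_mul]
    exact (mul_le_of_le_one_left (abs_nonneg _) (hε x)).trans (abs_energyDeriv_term_le x hu hp0)
  · refine summable_mul_of_abs_le hε hp (C := exp (2 * p)) fun x => ?_
    rw [abs_of_pos (Real.rpow_pos_of_pos (form_pos x hv) _)]
    exact form_rpow_le x hv hp0

lemma hasDerivAt_energyDeriv (hε : ∀ x, |ε x| ≤ 1) (hp : 1 < p) (hv : v ∈ Set.Ioo (-1 : ℝ) 1) :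
    HasDerivAt (energyDeriv ε p) (energyDeriv₂ ε p v) v := by
  have hp0 : 0 < p := by linarith
  refine hasDerivAt_tsum_of_isPreconnected (𝕜 := ℝ) (F := ℝ)
    (g := fun x v => ε x * (-2 * p * (form x v ^ (-p - 1) * formDeriv x v)))
    (g' := fun x v => ε x * (4 * p * (p + 1) * (form x v ^ (-p - 2) * formDeriv x v ^ 2) -
      4 * p * form x v ^ (-p)))
    ((summable_normSq_rpow hp).mul_left (4 * p * (p + 2) * exp (2 * p))) isOpen_Ioo
    isPreconnected_Ioo (fun x u hu => ?_) (fun x u hu => ?_) hv ?_ hv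
  · have hf := form_pos x hu
    refine ((((hasDerivAt_form x u).rpow_const (p := -p - 1) (Or.inl hf.ne')).mul
      (hasDerivAt_formDeriv x u)).const_mul (-2 * p)).const_mul (ε x) |>.congr_deriv ?_
    rw [show -p - 1 - 1 = -p - 2 by ring, Real.rpow_sub_one hf.ne']
    field_simp
    ring
  · rw [Real.norm_eq_abs, abs_mul]
    exact (mul_le_of_le_one_left (abs_nonneg _) (hε x)).trans (abs_energyDeriv₂_term_le x hu hp0)
  · exact summable_mul_of_abs_le hε hp fun x => abs_energyDeriv_term_le x hv hp0

lemma form_zero (x : PuncturedLattice) : form x 0 = normSq x := by simp [form, normSq]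

lemma formDeriv_zero (x : PuncturedLattice) :
    formDeriv x 0 = (x.1.1 : ℝ) ^ 2 - (x.1.2 : ℝ) ^ 2 := by simp [formDeriv]

lemma zero_mem_Ioo : (0 : ℝ) ∈ Set.Ioo (-1 : ℝ) 1 := by norm_num

lemma energyDeriv_zero (hsymm : ∀ x, ε (swap x) = ε x) (p : ℝ) : energyDeriv ε p 0 = 0 := by
  have h : energyDeriv ε p 0 = -energyDeriv ε p 0 := by
    unfold energyDeriv
    rw [← tsum_neg]
    conv_lhs => rw [← swap.tsum_eq]
    refine tsum_congr fun x => ?_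
    simp only [hsymm, form_zero, normSq_swap, formDeriv_zero, swap_fst, swap_snd]
    ring
  linarith

/-- The second derivative of the energy at the square lattice, as an unsymmetrized lattice sum. -/
lemma energyDeriv₂_zero (hε : ∀ x, |ε x| ≤ 1) (hsymm : ∀ x, ε (swap x) = ε x) (hp : 1 < p) :
    energyDeriv₂ ε p 0 = 4 * p * ∑' x : PuncturedLattice,
      ε x * (((p + 1) * ((x.1.2 : ℝ) ^ 2 - (x.1.1 : ℝ) ^ 2) ^ 2
        - 2 * (x.1.1 : ℝ) ^ 4 - 2 * (x.1.1 : ℝ) ^ 2 * (x.1.2 : ℝ) ^ 2)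
          / ((x.1.1 : ℝ) ^ 2 + (x.1.2 : ℝ) ^ 2) ^ (p + 2)) := by
  have hp0 : 0 < p := by linarith
  set g : PuncturedLattice → ℝ := fun x =>
    ε x * (((x.1.2 : ℝ) ^ 2 - (x.1.1 : ℝ) ^ 2) * normSq x ^ (-p - 1)) with hg
  have hgs : Summable g := by
    refine summable_mul_of_abs_le hε hp (C := 1) fun x => ?_
    have hr := normSq_pos x
    have h1 : |(x.1.2 : ℝ) ^ 2 - (x.1.1 : ℝ) ^ 2| ≤ normSq x := by
      unfold normSq
      rw [abs_le]
      constructor <;> nlinarith [sq_nonneg (x.1.1 : ℝ), sq_nonneg (x.1.2 : ℝ)]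
    rw [abs_mul, abs_of_pos (Real.rpow_pos_of_pos hr _), one_mul]
    calc _ ≤ normSq x * normSq x ^ (-p - 1) := by gcongr
      _ = normSq x ^ (-p) := by
        rw [Real.rpow_sub_one hr.ne']
        field_simp
  have hg0 : ∑' x, g x = 0 := by
    have h : ∑' x, g x = -∑' x, g x := by
      rw [← tsum_neg]
      conv_lhs => rw [← swap.tsum_eq]
      refine tsum_congr fun x => ?_
      simp only [hg, hsymm, normSq_swap, swap_fst, swap_snd]
      ring
    linarith
  have hE : Summable fun x => ε x * (4 * p * (p + 1) * (form x 0 ^ (-p - 2) * formDeriv x 0 ^ 2) -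
      4 * p * form x 0 ^ (-p)) :=
    summable_mul_of_abs_le hε hp fun x => abs_energyDeriv₂_term_le x zero_mem_Ioo hp0
  have hadd := hE.tsum_add (hgs.mul_left (4 * p))
  rw [tsum_mul_left, hg0, mul_zero, add_zero] at hadd
  unfold energyDeriv₂
  rw [← hadd, ← tsum_mul_left]
  refine tsum_congr fun x => ?_
  have hr := normSq_pos x
  simp only [hg, form_zero, formDeriv_zero]
  change _ = 4 * p * (ε x * (_ / normSq x ^ (p + 2)))
  rw [show (p + 2 : ℝ) = p + (2 : ℕ) by norm_num, Real.rpow_add_natCast hr.ne',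
    show (-p - 2 : ℝ) = -p - (2 : ℕ) by norm_num, Real.rpow_sub_natCast hr.ne',
    Real.rpow_sub_one hr.ne', Real.rpow_neg hr.le]
  have := Real.rpow_pos_of_pos hr p
  field_simp
  unfold normSq
  ring

end PuncturedLattice

open PuncturedLattice

/-- The sign `(-1)^{m+n}` of the alternating charge distribution. -/
def altCharge (x : PuncturedLattice) : ℝ := (-1) ^ (x.1.1 + x.1.2)

lemma abs_altCharge_le (x : PuncturedLattice) : |altCharge x| ≤ 1 := by simp [altCharge, abs_zpow]

lemma altCharge_swap (x : PuncturedLattice) : altCharge (swap x) = altCharge x := by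
  simp [altCharge, add_comm]

lemma S1_eq_energyDeriv₂ {p : ℝ} (hp : 1 < p) : S1 p = energyDeriv₂ (fun _ => 1) p 0 := by
  rw [energyDeriv₂_zero (by simp) (fun _ => rfl) hp]
  simp only [one_mul]
  rfl

lemma S2_eq_energyDeriv₂ {q : ℝ} (hq : 1 < q) : S2 q = energyDeriv₂ altCharge q 0 := by
  rw [energyDeriv₂_zero abs_altCharge_le altCharge_swap hq]
  simp only [← mul_div_assoc]
  rfl

lemma G_exp_eq (p q : ℝ) {V v : ℝ} (hV : 0 < V) :
    G p q V (exp v) =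
      V ^ (-p) * energy (fun _ => 1) p v + V ^ (-q) * energy altCharge q v := by
  have hform : ∀ x : PuncturedLattice, exp v ^ 2 * (x.1.1 : ℝ) ^ 2 +
      (exp v)⁻¹ ^ 2 * (x.1.2 : ℝ) ^ 2 = form x v := by
    intro x
    rw [form, ← Real.exp_neg, ← Real.exp_nat_mul, ← Real.exp_nat_mul]
    push_cast
    ring_nf
  have hnn : ∀ x : PuncturedLattice, 0 ≤ form x v := fun x => by
    unfold form
    positivity
  unfold G energy
  rw [← tsum_mul_left, ← tsum_mul_left]
  congr 1 <;> refine tsum_congr fun x => ?_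
  · rw [hform, Real.mul_rpow hV.le (hnn x), one_mul]
  · rw [hform, Real.mul_rpow hV.le (hnn x), altCharge]
    ring

/-- A strict form of the second derivative test. -/
lemma eventually_lt_of_second_deriv_neg {f f' : ℝ → ℝ} {f'' : ℝ}
    (h1 : ∀ᶠ v in 𝓝 0, HasDerivAt f (f' v) v)
    (h2 : HasDerivAt f' f'' 0) (h0 : f' 0 = 0) (hneg : f'' < 0) :
    ∀ᶠ v in 𝓝 0, v ≠ 0 → f v < f 0 := by
  have hg1 : ∀ᶠ v in 𝓝 (0 : ℝ), HasDerivAt (fun v => f v - f'' / 4 * v ^ 2)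
      (f' v - f'' / 2 * v) v := by
    filter_upwards [h1] with v hv
    refine (hv.sub ((hasDerivAt_pow 2 v).const_mul (f'' / 4))).congr_deriv ?_
    norm_num
    ring
  have hg2 : HasDerivAt (fun v => f' v - f'' / 2 * v) (f'' / 2) 0 := by
    refine (h2.sub ((hasDerivAt_id 0).const_mul (f'' / 2))).congr_deriv ?_
    ring
  have hd : deriv (fun v => f v - f'' / 4 * v ^ 2) =ᶠ[𝓝 0] fun v => f' v - f'' / 2 * v := by
    filter_upwards [hg1] with v hv using hv.deriv
  have hmax : IsLocalMax (fun v => f v - f'' / 4 * v ^ 2) 0 := by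
    refine isLocalMax_of_deriv_deriv_neg ?_ ?_ hg1.self_of_nhds.continuousAt
    · rw [hd.deriv_eq, hg2.deriv]
      linarith
    · rw [hd.self_of_nhds]
      simp [h0]
  filter_upwards [hmax] with v hv hv0
  have : 0 < v ^ 2 := by positivity
  norm_num at hv
  nlinarith

/-- A series of integrals is negative if the corresponding series of integrands is. -/
lemma tsum_integral_neg {α ι : Type*} [MeasurableSpace α] [Countable ι] {μ : Measure α}
    [NeZero μ] {F : ι → α → ℝ} (hF : ∀ i, Integrable (F i) μ)
    (hsum : Summable fun i => ∫ a, ‖F i a‖ ∂μ) (hneg : ∀ᵐ a ∂μ, ∑' i, F i a < 0) :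
    ∑' i, ∫ a, F i a ∂μ < 0 := by
  have hmeas : AEStronglyMeasurable (fun a => ∑' i, F i a) μ := by
    refine aestronglyMeasurable_of_tendsto_ae (u := atTop)
      (f := fun (s : Finset ι) a => ∑ i ∈ s, F i a)
      (fun s => Finset.aestronglyMeasurable_fun_sum s fun i _ => (hF i).1) ?_
    filter_upwards [hneg] with a ha
    have hs : Summable fun i => F i a := by
      by_contra h
      rw [tsum_eq_zero_of_not_summable h] at ha
      exact lt_irrefl _ ha
    exact hs.hasSum
  have hint : Integrable (fun a => ∑' i, F i a) μ := by
    refine ⟨hmeas, ?_⟩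
    calc ∫⁻ a, ‖∑' i, F i a‖ₑ ∂μ ≤ ∫⁻ a, ∑' i, ‖F i a‖ₑ ∂μ :=
          lintegral_mono fun a => enorm_tsum_le_tsum_enorm
      _ = ∑' i, ∫⁻ a, ‖F i a‖ₑ ∂μ := lintegral_tsum fun i => (hF i).1.enorm
      _ = ∑' i, ENNReal.ofReal (∫ a, ‖F i a‖ ∂μ) := by
          simp_rw [ofReal_integral_norm_eq_lintegral_enorm (hF _)]
      _ < ⊤ := hsum.tsum_ofReal_lt_top
  rw [integral_tsum_of_summable_integral_norm hF hsum]
  have hle : ∫ a, ∑' i, F i a ∂μ ≤ 0 := integral_nonpos_of_ae (hneg.mono fun a ha => ha.le)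
  refine lt_of_le_of_ne hle fun h0 => ?_
  have h1 : ∫ a, -∑' i, F i a ∂μ = 0 := by rw [integral_neg, h0, neg_zero]
  rw [integral_eq_zero_iff_of_nonneg_ae (hneg.mono fun a ha => (neg_pos.2 ha).le) hint.neg] at h1
  obtain ⟨a, ha, hb⟩ := (h1.and hneg).exists
  exact hb.ne (neg_eq_zero.1 ha)

lemma integrableOn_rpow_mul_exp {a r : ℝ} (ha : 0 < a) (hr : 0 < r) :
    IntegrableOn (fun t => t ^ (a - 1) * exp (-(r * t))) (Set.Ioi 0) := by
  refine Integrable.of_integral_ne_zero ?_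
  rw [Real.integral_rpow_mul_exp_neg_mul_Ioi ha hr]
  have := Real.Gamma_pos_of_pos ha
  positivity

namespace PuncturedLattice

/-- The Mellin integrand whose integral is the `x`-th term of `energyDeriv₂ altCharge q 0`, up to
the factor `4 / Γ(q)`. -/
def mellinTerm (q : ℝ) (x : PuncturedLattice) (t : ℝ) : ℝ :=
  altCharge x * (formDeriv x 0 ^ 2 * (t ^ (q + 2 - 1) * exp (-(normSq x * t))) -
    normSq x * (t ^ (q + 1 - 1) * exp (-(normSq x * t))))

lemma integrableOn_mellinTerm {q : ℝ} (hq : 1 < q) (x : PuncturedLattice) :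
    IntegrableOn (mellinTerm q x) (Set.Ioi 0) :=
  (((integrableOn_rpow_mul_exp (by linarith) (normSq_pos x)).const_mul _).sub
    ((integrableOn_rpow_mul_exp (by linarith) (normSq_pos x)).const_mul _)).const_mul _

lemma integral_mellinTerm {q : ℝ} (hq : 1 < q) (x : PuncturedLattice) :
    ∫ t in Set.Ioi 0, mellinTerm q x t =
      Gamma q / 4 * (altCharge x * (4 * q * (q + 1) * (form x 0 ^ (-q - 2) * formDeriv x 0 ^ 2) -
        4 * q * form x 0 ^ (-q))) := by
  have hr := normSq_pos x
  have h2 : Gamma (q + 2) = (q + 1) * (q * Gamma q) := by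
    rw [show q + 2 = q + 1 + 1 by ring, Real.Gamma_add_one (by linarith),
      Real.Gamma_add_one (by linarith)]
  unfold mellinTerm
  rw [integral_const_mul, integral_sub
    ((integrableOn_rpow_mul_exp (by linarith) hr).const_mul _)
    ((integrableOn_rpow_mul_exp (by linarith) hr).const_mul _), integral_const_mul,
    integral_const_mul, Real.integral_rpow_mul_exp_neg_mul_Ioi (by linarith) hr,
    Real.integral_rpow_mul_exp_neg_mul_Ioi (by linarith) hr, h2,
    Real.Gamma_add_one (by linarith), form_zero, one_div, Real.inv_rpow hr.le,
    Real.inv_rpow hr.le, ← Real.rpow_neg hr.le, ← Real.rpow_neg hr.le,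
    show -(q + 1) = -q - 1 by ring, Real.rpow_sub_one hr.ne', show -(q + 2) = -q - 2 by ring]
  field_simp

lemma integral_norm_mellinTerm_le {q : ℝ} (hq : 1 < q) (x : PuncturedLattice) :
    ∫ t in Set.Ioi 0, ‖mellinTerm q x t‖ ≤ (Gamma (q + 2) + Gamma (q + 1)) * normSq x ^ (-q) := by
  have hr := normSq_pos x
  have i2 := (integrableOn_rpow_mul_exp (a := q + 2) (by linarith) hr).const_mul (normSq x ^ 2)
  have i1 := (integrableOn_rpow_mul_exp (a := q + 1) (by linarith) hr).const_mul (normSq x)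
  calc ∫ t in Set.Ioi 0, ‖mellinTerm q x t‖
      ≤ ∫ t in Set.Ioi 0, (normSq x ^ 2 * (t ^ (q + 2 - 1) * exp (-(normSq x * t))) +
          normSq x * (t ^ (q + 1 - 1) * exp (-(normSq x * t)))) := by
        refine setIntegral_mono_on (integrableOn_mellinTerm hq x).norm (i2.add i1)
          measurableSet_Ioi fun t ht => ?_
        have ht' : 0 < t := ht
        have hD : formDeriv x 0 ^ 2 ≤ normSq x ^ 2 := by
          rw [← form_zero]
          exact sq_le_sq' (abs_le.1 (abs_formDeriv_le x 0)).1 (abs_le.1 (abs_formDeriv_le x 0)).2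
        unfold mellinTerm
        rw [norm_mul]
        refine (mul_le_of_le_one_left (norm_nonneg _) (abs_altCharge_le x)).trans
          ((norm_sub_le _ _).trans ?_)
        rw [Real.norm_of_nonneg (by positivity), Real.norm_of_nonneg (by positivity)]
        gcongr
    _ = _ := by
        rw [integral_add i2 i1, integral_const_mul, integral_const_mul,
          Real.integral_rpow_mul_exp_neg_mul_Ioi (by linarith) hr,
          Real.integral_rpow_mul_exp_neg_mul_Ioi (by linarith) hr, one_div, Real.inv_rpow hr.le,
          Real.inv_rpow hr.le, ← Real.rpow_neg hr.le, ← Real.rpow_neg hr.le,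
          show -(q + 1) = -q - 1 by ring, Real.rpow_sub_one hr.ne',
          show -(q + 2) = -q - 1 - 1 by ring, Real.rpow_sub_one hr.ne', Real.rpow_sub_one hr.ne']
        field_simp

lemma tsum_mellinTerm (q : ℝ) {t : ℝ} (ht : 0 < t) :
    ∑' x, mellinTerm q x t =
      2 * t ^ q * (t * (thetaMoment (fun n => (-1) ^ n) 0 0 t *
        thetaMoment (fun n => (-1) ^ n) 0 2 t - thetaMoment (fun n => (-1) ^ n) 0 1 t ^ 2) -
        thetaMoment (fun n => (-1) ^ n) 0 0 t * thetaMoment (fun n => (-1) ^ n) 0 1 t) := by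
  set a : ℕ → ℤ → ℝ := fun j n =>
    (-1) ^ n * (((n : ℝ) + 0) ^ 2) ^ j * exp (-(t * ((n : ℝ) + 0) ^ 2)) with ha
  have hs : ∀ j, Summable fun n => ‖a j n‖ := fun j =>
    (summable_thetaMoment abs_neg_one_zpow_le 0 j ht).norm
  have hprod : ∀ i j, HasSum (fun z : ℤ × ℤ => a i z.1 * a j z.2)
      (thetaMoment (fun n => (-1) ^ n) 0 i t * thetaMoment (fun n => (-1) ^ n) 0 j t) := by
    intro i j
    have h := (summable_mul_of_summable_norm (hs i) (hs j)).hasSum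
    rwa [← tsum_mul_tsum_of_summable_norm (hs i) (hs j)] at h
  have key := ((((hprod 2 0).sub ((hprod 1 1).mul_left 2)).add (hprod 0 2)).mul_left t |>.sub
    ((hprod 1 0).add (hprod 0 1))).mul_left (t ^ q)
  have hterm : ∀ x : PuncturedLattice, mellinTerm q x t =
      t ^ q * (t * (a 2 x.1.1 * a 0 x.1.2 - 2 * (a 1 x.1.1 * a 1 x.1.2) + a 0 x.1.1 * a 2 x.1.2) -
        (a 1 x.1.1 * a 0 x.1.2 + a 0 x.1.1 * a 1 x.1.2)) := by
    intro x
    have he : exp (-(normSq x * t)) =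
        exp (-(t * (x.1.1 : ℝ) ^ 2)) * exp (-(t * (x.1.2 : ℝ) ^ 2)) := by
      rw [← Real.exp_add, normSq]
      ring_nf
    simp only [mellinTerm, ha, add_zero, altCharge]
    rw [he, formDeriv_zero, zpow_add₀ (by norm_num), show q + 2 - 1 = q + 1 by ring,
      show q + 1 - 1 = q by ring, Real.rpow_add_one ht.ne', normSq]
    ring
  simp_rw [hterm]
  have hsupp := key.tsum_eq
  rw [← tsum_subtype_eq_of_support_subset (s := {x : ℤ × ℤ | x ≠ 0})] at hsupp
  · refine hsupp.trans ?_
    ring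
  · intro z hz h0
    rw [h0] at hz
    simp [ha] at hz

/-- The alternating sum `S₂(q)` is negative. -/
lemma S2_neg {q : ℝ} (hq : 1 < q) : S2 q < 0 := by
  have : NeZero (volume.restrict (Set.Ioi (0 : ℝ))) := ⟨by simp⟩
  have hneg : ∑' x, ∫ t in Set.Ioi 0, mellinTerm q x t < 0 := by
    refine tsum_integral_neg (integrableOn_mellinTerm hq) ?_ ?_
    · exact ((summable_normSq_rpow hq).mul_left _).of_nonneg_of_le
        (fun x => integral_nonneg fun _ => norm_nonneg _) (integral_norm_mellinTerm_le hq)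
    · filter_upwards [ae_restrict_mem measurableSet_Ioi] with t ht
      rw [tsum_mellinTerm q ht]
      exact mul_neg_of_pos_of_neg (mul_pos two_pos (Real.rpow_pos_of_pos ht q))
        (thetaMoment_alternating_log_concave ht)
  simp_rw [integral_mellinTerm hq] at hneg
  rw [tsum_mul_left] at hneg
  rw [S2_eq_energyDeriv₂ hq]
  have hG := Real.Gamma_pos_of_pos (by linarith : 0 < q)
  exact (pos_iff_neg_of_mul_neg hneg).1 (by positivity)

end PuncturedLattice

/-- For `V > V_{p,q} = (S₁(p)/(-S₂(q)))^{1/(p-q)}`, `y = 1` is a strict local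
maximum of `G_V` on `(0,∞)`. -/
theorem square_strict_local_max
    (p q V : ℝ) (hq : 1 < q) (hpq : q < p) (hV0 : 0 < V)
    (hV : V > (S1 p / (-S2 q)) ^ ((1 : ℝ) / (p - q))) :
    ∃ δ : ℝ, 0 < δ ∧ ∀ y : ℝ, 0 < y → |y - 1| < δ → y ≠ 1 →
      G p q V y < G p q V 1 := by
  have hp : 1 < p := hq.trans hpq
  have hS2 := S2_neg hq
  have hVp : 0 < V ^ (-p) := Real.rpow_pos_of_pos hV0 _
  have hVq : 0 < V ^ (-q) := Real.rpow_pos_of_pos hV0 _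
  have hneg : V ^ (-p) * S1 p + V ^ (-q) * S2 q < 0 := by
    rcases le_or_gt (S1 p) 0 with h | h
    · have := mul_nonpos_of_nonneg_of_nonpos hVp.le h
      have := mul_neg_of_pos_of_neg hVq hS2
      linarith
    · have hr : 0 < S1 p / -S2 q := div_pos h (by linarith)
      have h1 : S1 p / -S2 q < V ^ (p - q) := by
        have := Real.rpow_lt_rpow (by positivity) hV (sub_pos.2 hpq)
        rwa [← Real.rpow_mul hr.le, one_div, inv_mul_cancel₀ (sub_pos.2 hpq).ne',
          Real.rpow_one] at this
      rw [div_lt_iff₀ (by linarith)] at h1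
      have h2 : V ^ (-q) = V ^ (-p) * V ^ (p - q) := by
        rw [← Real.rpow_add hV0]
        ring_nf
      rw [h2]
      nlinarith
  rw [S1_eq_energyDeriv₂ hp, S2_eq_energyDeriv₂ hq] at hneg
  have hone : ∀ x : PuncturedLattice, |(fun _ => 1 : PuncturedLattice → ℝ) x| ≤ 1 := by simp
  have hev := eventually_lt_of_second_deriv_neg
    (f := fun v => V ^ (-p) * energy (fun _ => 1) p v + V ^ (-q) * energy altCharge q v)
    (f' := fun v => V ^ (-p) * energyDeriv (fun _ => 1) p v + V ^ (-q) * energyDeriv altCharge q v)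
    (by
      filter_upwards [isOpen_Ioo.mem_nhds zero_mem_Ioo] with v hv
      exact ((hasDerivAt_energy hone hp hv).const_mul _).add
        ((hasDerivAt_energy abs_altCharge_le hq hv).const_mul _))
    (((hasDerivAt_energyDeriv hone hp zero_mem_Ioo).const_mul _).add
      ((hasDerivAt_energyDeriv abs_altCharge_le hq zero_mem_Ioo).const_mul _))
    (by simp [energyDeriv_zero (ε := fun _ => 1) (fun _ => rfl),
      energyDeriv_zero altCharge_swap]) hneg
  have hlog : Tendsto Real.log (𝓝 1) (𝓝 0) := by
    simpa using (Real.continuousAt_log one_ne_zero).tendsto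
  obtain ⟨δ, hδ, h⟩ := Metric.eventually_nhds_iff.1 (hlog.eventually hev)
  refine ⟨δ, hδ, fun y hy hyδ hy1 => ?_⟩
  have := h (by rwa [Real.dist_eq]) (Real.log_ne_zero_of_pos_of_ne_one hy hy1)
  rw [← G_exp_eq p q hV0, ← G_exp_eq p q hV0, Real.exp_log hy, Real.exp_zero] at this
  exact this
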